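/- For all x ∈ [0, π_{2,3}/2), writing s = sin_{2,3}(x) and c = cos_{2,3}(x), one has sin_{2,3}(2x) = 4 s c (3 + c)^3 / ((1 + c)(8 + s^3)^2). -/

import Mathlib

open MeasureTheory Set
open scoped ENNReal

/-- `genF p q y = ∫_0^y (1 - t^q)^(-1/p) dt`, whose inverse is the generalized sine. -/
noncomputable def genF (p q y : ℝ) : ℝ := ∫ t in (0:ℝ)..y, (1 - t ^ q) ^ (-(1 / p))

/-- `genG p q y = ∫_0^y (1 + t^q)^(-1/p) dt`, whose inverse is the generalized hyperbolic sine. -/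
noncomputable def genG (p q y : ℝ) : ℝ := ∫ t in (0:ℝ)..y, (1 + t ^ q) ^ (-(1 / p))

/-- The generalized π, `π_{p,q} = 2∫_0^1 (1 - t^q)^(-1/p) dt`, as an extended real number
(it is `∞` when `q/(q+1) < p ≤ 1`). -/
noncomputable def genPi (p q : ℝ) : ℝ≥0∞ :=
  2 * ∫⁻ t in Ioo (0:ℝ) 1, ENNReal.ofReal ((1 - t ^ q) ^ (-(1 / p)))

/-- The generalized sine `sin_{p,q}`: the inverse of `genF p q`, which maps `[0,1)` onto
`[0, π_{p,q}/2)`. -/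
noncomputable def gsin (p q : ℝ) : ℝ → ℝ := Function.invFunOn (genF p q) (Ico 0 1)

/-- The generalized cosine `cos_{p,q} x = (d/dx) sin_{p,q} x` (one-sided at `x = 0`). -/
noncomputable def gcos (p q x : ℝ) : ℝ := derivWithin (gsin p q) (Ici 0) x

/-- The generalized hyperbolic sine `sinh_{p,q}`: the inverse of `genG p q`, which maps
`[0,∞)` onto `[0, π_{r,q}/2)` where `r = pq/(pq+p-q)`. -/
noncomputable def gsinh (p q : ℝ) : ℝ → ℝ := Function.invFunOn (genG p q) (Ici 0)

/-- The generalized hyperbolic cosine `cosh_{p,q} x = (d/dx) sinh_{p,q} x`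
(one-sided at `x = 0`). -/
noncomputable def gcosh (p q x : ℝ) : ℝ := derivWithin (gsinh p q) (Ici 0) x

/-- The generalized π, `π_{p,q} = 2∫_0^1 (1 - t^q)^(-1/p) dt`, as a real number
(valid for `p > 1`, where the integral converges). -/
noncomputable def genPiR (p q : ℝ) : ℝ := 2 * ∫ t in (0:ℝ)..1, (1 - t ^ q) ^ (-(1 / p))

/-- The generalized sine `sin_{2,3}` as the inverse of `genF 2 3 : [0,1] → [0, π_{2,3}/2]`,
extended to `[0, π_{2,3}]` by the symmetry `sin_{2,3}(π_{2,3} - x) = sin_{2,3} x`. -/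
noncomputable def sin23 (x : ℝ) : ℝ :=
  if x ≤ genPiR 2 3 / 2 then Function.invFunOn (genF 2 3) (Icc 0 1) x
  else Function.invFunOn (genF 2 3) (Icc 0 1) (genPiR 2 3 - x)

/-- `cos_{2,3} x = (1 - (sin_{2,3} x)^3)^(1/2)` on `[0, π_{2,3}/2]`. -/
noncomputable def cos23 (x : ℝ) : ℝ := Real.sqrt (1 - sin23 x ^ 3)

lemma genF_two_three_integrand {t : ℝ} (ht : t ≤ 1) :
    (1 - t ^ (3:ℝ)) ^ (-(1 / (2:ℝ))) = (√(1 - t ^ 3))⁻¹ := by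
  have h3 : t ^ (3:ℝ) = t ^ 3 := by exact_mod_cast Real.rpow_natCast t 3
  have h : 0 ≤ 1 - t ^ 3 := by nlinarith [sq_nonneg (t + 1), sq_nonneg t]
  rw [h3, Real.rpow_neg h, ← Real.sqrt_eq_rpow]

lemma genF_two_three_eq {y : ℝ} (hy : y ∈ Icc (0:ℝ) 1) :
    genF 2 3 y = ∫ t in (0:ℝ)..y, (√(1 - t ^ 3))⁻¹ := by
  refine intervalIntegral.integral_congr fun t ht => ?_
  rw [uIcc_of_le hy.1] at ht
  exact genF_two_three_integrand (ht.2.trans hy.2)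

lemma intervalIntegrable_inv_sqrt_one_sub_cube :
    IntervalIntegrable (fun t : ℝ => (√(1 - t ^ 3))⁻¹) volume 0 1 := by
  have h1 : IntervalIntegrable (fun t : ℝ => (1 - t) ^ (-(1 / 2) : ℝ)) volume 0 1 := by
    have h := (intervalIntegral.intervalIntegrable_rpow' (a := 1) (b := 0)
      (r := (-(1 / 2) : ℝ)) (by norm_num)).comp_sub_left 1
    simpa using h
  refine h1.mono_fun (by measurability) ?_
  rw [uIoc_of_le zero_le_one, ← restrict_Ioo_eq_restrict_Ioc]
  filter_upwards [ae_restrict_mem measurableSet_Ioo] with t ht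
  have ht1 : 0 < 1 - t := by linarith [ht.2]
  rw [Real.rpow_neg ht1.le, ← Real.sqrt_eq_rpow, norm_inv, norm_inv,
    Real.norm_of_nonneg (Real.sqrt_nonneg _), Real.norm_of_nonneg (Real.sqrt_nonneg _)]
  have h0 : 0 < √(1 - t) := Real.sqrt_pos.2 ht1
  gcongr
  nlinarith [ht.1, mul_pos ht.1 ht1, mul_pos (mul_pos ht.1 ht1) ht.1]

lemma continuousOn_genF_two_three : ContinuousOn (genF 2 3) (Icc 0 1) := by
  have h := intervalIntegral.continuousOn_primitive_interval'
    intervalIntegrable_inv_sqrt_one_sub_cube left_mem_uIcc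
  rw [uIcc_of_le zero_le_one] at h
  exact h.congr fun y hy => genF_two_three_eq hy

lemma one_sub_cube_pos {y : ℝ} (hy : y < 1) : 0 < 1 - y ^ 3 := by
  nlinarith [sq_nonneg (2 * y + 1)]

lemma hasDerivAt_genF_two_three {y : ℝ} (hy : y ∈ Ioo (0:ℝ) 1) :
    HasDerivAt (genF 2 3) (√(1 - y ^ 3))⁻¹ y := by
  have hint : IntervalIntegrable (fun t : ℝ => (√(1 - t ^ 3))⁻¹) volume 0 y :=
    intervalIntegrable_inv_sqrt_one_sub_cube.mono_set
      (uIcc_subset_uIcc left_mem_uIcc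
        (by rw [uIcc_of_le zero_le_one]; exact Ioo_subset_Icc_self hy))
  have hd := intervalIntegral.integral_hasDerivAt_right hint
    (Measurable.stronglyMeasurable (by measurability)).stronglyMeasurableAtFilter
    (by
      have : √(1 - y ^ 3) ≠ 0 := (Real.sqrt_pos.2 (one_sub_cube_pos hy.2)).ne'
      fun_prop (disch := assumption))
  refine hd.congr_of_eventuallyEq ?_
  filter_upwards [Ioo_mem_nhds hy.1 hy.2] with z hz
  exact genF_two_three_eq (Ioo_subset_Icc_self hz)

lemma strictMonoOn_genF_two_three : StrictMonoOn (genF 2 3) (Icc 0 1) := by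
  refine strictMonoOn_of_deriv_pos (convex_Icc 0 1) continuousOn_genF_two_three fun y hy => ?_
  rw [interior_Icc] at hy
  rw [(hasDerivAt_genF_two_three hy).deriv]
  exact inv_pos.2 (Real.sqrt_pos.2 (one_sub_cube_pos hy.2))

lemma genF_two_three_zero : genF 2 3 0 = 0 := by simp [genF]

lemma genF_two_three_one : genF 2 3 1 = genPiR 2 3 / 2 := by simp [genF, genPiR]

lemma invFunOn_genF_two_three {y : ℝ} (hy : y ∈ Icc (0:ℝ) 1) :
    Function.invFunOn (genF 2 3) (Icc 0 1) (genF 2 3 y) = y :=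
  strictMonoOn_genF_two_three.injOn.leftInvOn_invFunOn hy

lemma sin23_genF {y : ℝ} (hy : y ∈ Icc (0:ℝ) 1) : sin23 (genF 2 3 y) = y := by
  have h : genF 2 3 y ≤ genPiR 2 3 / 2 := genF_two_three_one ▸
    strictMonoOn_genF_two_three.monotoneOn hy (right_mem_Icc.2 zero_le_one) hy.2
  rw [sin23, if_pos h, invFunOn_genF_two_three hy]

lemma sin23_genPiR_sub {x : ℝ} : sin23 (genPiR 2 3 - x) = sin23 x := by
  unfold sin23
  rcases lt_trichotomy x (genPiR 2 3 / 2) with h | h | h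
  · rw [if_neg (by linarith), if_pos h.le, sub_sub_cancel]
  · simp only [show genPiR 2 3 - x = x by linarith, ite_self]
  · rw [if_pos (by linarith), if_neg h.not_ge]

/-- The right-hand side of the double-angle formula, as a function of `s = sin_{2,3} x`. -/
noncomputable def doubleSin (s : ℝ) : ℝ :=
  4 * s * (√(1 - s ^ 3) * (3 + √(1 - s ^ 3)) / ((1 + √(1 - s ^ 3)) * (3 - √(1 - s ^ 3)) ^ 2))

/-- The numerator of `cos_{2,3} (2x)` as a polynomial in `c = cos_{2,3} x`; the denominator is
`(1 + c) * (3 - c) ^ 3`. -/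
def doubleCosNum (c : ℝ) : ℝ := c ^ 4 + 24 * c ^ 3 + 18 * c ^ 2 - 27

lemma strictMonoOn_doubleCosNum : StrictMonoOn doubleCosNum (Ici 0) := by
  intro a (ha : 0 ≤ a) b _ hab
  unfold doubleCosNum
  gcongr

section

variable {s : ℝ}

lemma sqrt_one_sub_cube_le_one (hs : 0 ≤ s) : √(1 - s ^ 3) ≤ 1 :=
  Real.sqrt_le_one.2 (by linarith [pow_nonneg hs 3])

lemma sqrt_one_sub_cube_sq (hs : s ≤ 1) : √(1 - s ^ 3) ^ 2 = 1 - s ^ 3 :=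
  Real.sq_sqrt (by nlinarith [sq_nonneg (2 * s + 1)])

lemma sqrt_one_sub_cube_lt {t : ℝ} (hs : 0 ≤ s) (hst : s < t) (ht : t ≤ 1) :
    √(1 - t ^ 3) < √(1 - s ^ 3) :=
  Real.sqrt_lt_sqrt (by linarith [pow_le_one₀ (n := 3) (hs.trans hst.le) ht])
    (by linarith [pow_lt_pow_left₀ hst hs three_ne_zero])

lemma one_sub_doubleSin_cube (hs : s ∈ Icc (0:ℝ) 1) :
    1 - doubleSin s ^ 3 =
      (doubleCosNum √(1 - s ^ 3) / ((1 + √(1 - s ^ 3)) * (3 - √(1 - s ^ 3)) ^ 3)) ^ 2 := by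
  have hc0 := Real.sqrt_nonneg (1 - s ^ 3)
  have hc1 := sqrt_one_sub_cube_le_one hs.1
  have hc2 := sqrt_one_sub_cube_sq hs.2
  unfold doubleSin doubleCosNum
  generalize √(1 - s ^ 3) = c at *
  have h1 : 1 + c ≠ 0 := by positivity
  have h3 : 3 - c ≠ 0 := by linarith
  rw [mul_pow, mul_pow, show s ^ 3 = 1 - c ^ 2 by linarith]
  field_simp
  ring

lemma doubleSin_nonneg (hs : 0 ≤ s) : 0 ≤ doubleSin s := by
  unfold doubleSin; positivity

lemma doubleSin_mem_Icc (hs : s ∈ Icc (0:ℝ) 1) : doubleSin s ∈ Icc (0:ℝ) 1 := by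
  refine ⟨doubleSin_nonneg hs.1, ?_⟩
  have h := one_sub_doubleSin_cube hs
  by_contra! hlt
  have := one_lt_pow₀ hlt three_ne_zero
  nlinarith [sq_nonneg
    (doubleCosNum √(1 - s ^ 3) / ((1 + √(1 - s ^ 3)) * (3 - √(1 - s ^ 3)) ^ 3))]

lemma hasDerivAt_doubleSin (hs : s ∈ Ioo (0:ℝ) 1) :
    HasDerivAt doubleSin (2 * (doubleCosNum √(1 - s ^ 3) /
      ((1 + √(1 - s ^ 3)) * (3 - √(1 - s ^ 3)) ^ 3)) / √(1 - s ^ 3)) s := by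
  have hpos := one_sub_cube_pos hs.2
  have hc0 := Real.sqrt_pos.2 hpos
  have hc1 := sqrt_one_sub_cube_le_one hs.1.le
  have hc2 := sqrt_one_sub_cube_sq hs.2.le
  have hcd : HasDerivAt (fun s : ℝ => √(1 - s ^ 3)) _ s :=
    (((hasDerivAt_id s).pow 3).const_sub 1).sqrt hpos.ne'
  have h1 : 1 + √(1 - s ^ 3) ≠ 0 := by positivity
  have h3 : 3 - √(1 - s ^ 3) ≠ 0 := by linarith
  have hd := ((hasDerivAt_id s).const_mul 4).mul ((hcd.mul (hcd.const_add 3)).div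
    ((hcd.const_add 1).mul ((hcd.const_sub 3).pow 2)) (mul_ne_zero h1 (pow_ne_zero 2 h3)))
  refine hd.congr_deriv ?_
  unfold doubleCosNum
  simp only [id, Pi.mul_apply, Pi.div_apply, Pi.pow_apply]
  generalize √(1 - s ^ 3) = c at *
  have hc : c ≠ 0 := hc0.ne'
  have e : s ^ 3 = 1 - c ^ 2 := by linarith
  field_simp
  ring_nf
  simp only [e]
  ring

lemma continuousOn_doubleSin : ContinuousOn doubleSin (Icc 0 1) := by
  have h : ∀ s ∈ Icc (0:ℝ) 1, (1 + √(1 - s ^ 3)) * (3 - √(1 - s ^ 3)) ^ 2 ≠ 0 := fun s hs => by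
    have := sqrt_one_sub_cube_le_one hs.1
    have h3 : 3 - √(1 - s ^ 3) ≠ 0 := by linarith
    positivity
  unfold doubleSin
  fun_prop (disch := assumption)

lemma genF_doubleSin_sub_genF_doubleSin {a b ε : ℝ} (ha : 0 ≤ a) (hab : a ≤ b) (hb : b ≤ 1)
    (hε : ε ^ 2 = 1) (hq : ∀ s ∈ Ioo a b, 0 < ε * doubleCosNum √(1 - s ^ 3)) :
    genF 2 3 (doubleSin b) - genF 2 3 (doubleSin a) = 2 * ε * (genF 2 3 b - genF 2 3 a) := by
  rcases hab.eq_or_lt with rfl | hlt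
  · simp
  have hsub : Icc a b ⊆ Icc 0 1 := Icc_subset_Icc ha hb
  have hcont : ContinuousOn (fun s => genF 2 3 (doubleSin s) - 2 * ε * genF 2 3 s) (Icc a b) :=
    ((continuousOn_genF_two_three.comp continuousOn_doubleSin
      fun _ => doubleSin_mem_Icc).mono hsub).sub
      ((continuousOn_genF_two_three.mono hsub).const_mul (2 * ε))
  obtain ⟨t, -, ht⟩ := exists_hasDerivAt_eq_slope _ (fun _ => 0) hlt hcont fun s hs => by
    have hs' : s ∈ Ioo (0:ℝ) 1 := Ioo_subset_Ioo ha hb hs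
    have hsI := Ioo_subset_Icc_self hs'
    have hc0 := Real.sqrt_pos.2 (one_sub_cube_pos hs'.2)
    have hc1 := sqrt_one_sub_cube_le_one hs'.1.le
    have h3 : 0 < 3 - √(1 - s ^ 3) := by linarith
    set E := doubleCosNum √(1 - s ^ 3) / ((1 + √(1 - s ^ 3)) * (3 - √(1 - s ^ 3)) ^ 3) with hE
    have hcube : 1 - doubleSin s ^ 3 = E ^ 2 := one_sub_doubleSin_cube hsI
    have hεE : 0 < ε * E := by
      rw [hE, ← mul_div_assoc]
      exact div_pos (hq s hs) (by positivity)
    have hE0 : E ≠ 0 := right_ne_zero_of_mul hεE.ne'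
    have hε0 : ε ≠ 0 := left_ne_zero_of_mul hεE.ne'
    have hsqrt : √(1 - doubleSin s ^ 3) = ε * E := by
      rw [hcube, ← one_mul (E ^ 2), ← hε, ← mul_pow, Real.sqrt_sq hεE.le]
    have hD : doubleSin s ∈ Ioo (0:ℝ) 1 := by
      refine ⟨?_, (doubleSin_mem_Icc hsI).2.lt_of_ne fun h => ?_⟩
      · have := hs'.1
        unfold doubleSin
        positivity
      · rw [h] at hcube
        exact hE0 (by simpa using hcube.symm)
    have hd := ((hasDerivAt_genF_two_three hD).comp s (hasDerivAt_doubleSin hs')).sub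
      ((hasDerivAt_genF_two_three hs').const_mul (2 * ε))
    refine hd.congr_deriv ?_
    rw [hsqrt, ← hE]
    field_simp
    linear_combination -2 * hε
  rw [eq_comm, div_eq_zero_iff] at ht
  rcases ht with ht | ht <;> linarith

lemma doubleSin_zero : doubleSin 0 = 0 := by simp [doubleSin]

lemma doubleSin_one : doubleSin 1 = 0 := by simp [doubleSin]

lemma sin23_two_mul_genF (hs : s ∈ Icc (0:ℝ) 1) : sin23 (2 * genF 2 3 s) = doubleSin s := by
  have hD := doubleSin_mem_Icc hs
  rcases le_total 0 (doubleCosNum √(1 - s ^ 3)) with h | h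
  · have key := genF_doubleSin_sub_genF_doubleSin (ε := 1) le_rfl hs.1 hs.2 (by norm_num)
      fun t ht => by
        rw [one_mul]
        exact h.trans_lt (strictMonoOn_doubleCosNum (Real.sqrt_nonneg _) (Real.sqrt_nonneg _)
          (sqrt_one_sub_cube_lt ht.1.le ht.2 hs.2))
    rw [doubleSin_zero, genF_two_three_zero] at key
    rw [show 2 * genF 2 3 s = genF 2 3 (doubleSin s) by linarith, sin23_genF hD]
  · have key := genF_doubleSin_sub_genF_doubleSin (ε := -1) hs.1 hs.2 le_rfl (by norm_num)
      fun t ht => by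
        have := (strictMonoOn_doubleCosNum (Real.sqrt_nonneg _) (Real.sqrt_nonneg _)
          (sqrt_one_sub_cube_lt hs.1 ht.1 ht.2.le)).trans_le h
        linarith
    rw [doubleSin_one, genF_two_three_zero, genF_two_three_one] at key
    rw [show 2 * genF 2 3 s = genPiR 2 3 - genF 2 3 (doubleSin s) by linarith,
      sin23_genPiR_sub, sin23_genF hD]

end

/-- double-angle formula for `sin_{2,3}` on `[0, π_{2,3}/2)`. -/
theorem double_angle_sin_two_three (x : ℝ) (hx0 : 0 ≤ x) (hx : x < genPiR 2 3 / 2)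
    (s c : ℝ) (hs : s = sin23 x) (hc : c = cos23 x) :
    sin23 (2 * x) = 4 * s * c * (3 + c) ^ 3 / ((1 + c) * (8 + s ^ 3) ^ 2) := by
  obtain ⟨y, hy, rfl⟩ : x ∈ genF 2 3 '' Icc 0 1 :=
    intermediate_value_Icc zero_le_one continuousOn_genF_two_three
      ⟨genF_two_three_zero.trans_le hx0, genF_two_three_one ▸ hx.le⟩
  rw [cos23, sin23_genF hy] at hc
  rw [sin23_genF hy] at hs
  subst hs
  have hc0 : 0 ≤ c := hc ▸ Real.sqrt_nonneg _
  have hc1 : c ≤ 1 := hc ▸ sqrt_one_sub_cube_le_one hy.1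
  have hc2 : c ^ 2 = 1 - s ^ 3 := hc ▸ sqrt_one_sub_cube_sq hy.2
  rw [sin23_two_mul_genF hy, doubleSin, ← hc,
    show 8 + s ^ 3 = (3 - c) * (3 + c) by linear_combination hc2]
  have h3 : 3 - c ≠ 0 := by linarith
  field_simp
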